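/- arXiv:2407.05127 — 2 statements merged into one kernel-verified Lean document; each statement's English description precedes it below -/
import Mathlib

section
/- Let S = {s_1, …, s_n} be a finite set, k a positive integer with 2 ≤ k ≤ n, f : 2^S → ℝ a k-distant submodular function with f(∅) = 0, and w ∈ ℝ_+^S a nonnegative weight vector with w(s_1) > w(s_2) > ⋯ > w(s_n). Set S_0 = ∅, S_i = {s_1, …, s_i} for 1 ≤ i ≤ n, 𝒞 = {S_i Δ T : 0 ≤ i ≤ n, T ⊆ S, |T| ≤ k−2}, and P_𝒞(f) = {x ∈ ℝ^S : x(T) ≤ f(T) for every T ∈ 𝒞}, where x(T) = ∑_{s ∈ T} x(s). If x* is an extreme point of P_𝒞(f) that maximizes w^⊤ x over P_𝒞(f), then x*(T) ≤ f(T) holds for every T ⊆ S, i.e., x* ∈ P(f) = {x ∈ ℝ^S : x(T) ≤ f(T) for every T ⊆ S}. -/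
open scoped symmDiff

/-- A set function `f` on subsets of a finite type is `k`-distant submodular if the
submodular inequality holds for every pair whose symmetric difference has size at least `k`. -/
def DistantSubmodular {α : Type*} [DecidableEq α] (k : ℕ) (f : Finset α → ℝ) : Prop :=
  ∀ X Y : Finset α, k ≤ (X ∆ Y).card → f (X ∪ Y) + f (X ∩ Y) ≤ f X + f Y

/-- `initSeg n i = S_i = {s_1, …, s_i}`, the first `i` elements of `Fin n`. -/
def initSeg (n : ℕ) (i : ℕ) : Finset (Fin n) :=
  Finset.univ.filter (fun j : Fin n => (j : ℕ) < i)

/-- The polyhedron `{x | x(A) ≤ f(A) for all A ∈ D}`. -/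
def setPolyhedron {α : Type*} (D : Set (Finset α)) (f : Finset α → ℝ) : Set (α → ℝ) :=
  {x | ∀ A ∈ D, ∑ s ∈ A, x s ≤ f A}

/-- The sets within symmetric difference at most `r` of some initial segment. -/
def nearInitSeg (n r : ℕ) : Set (Finset (Fin n)) :=
  {U | ∃ i ≤ n, ∃ T : Finset (Fin n), T.card ≤ r ∧ U = initSeg n i ∆ T}

theorem sum_add_smul_apply {α : Type*} (A : Finset α) (x d : α → ℝ) (t : ℝ) :
    ∑ s ∈ A, (x + t • d) s = ∑ s ∈ A, x s + t * ∑ s ∈ A, d s := by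
  simp [Finset.sum_add_distrib, Finset.mul_sum]

/-- A direction that increases no tight constraint is feasible. -/
theorem eventually_add_smul_mem_setPolyhedron {α : Type*} [Finite α] {D : Set (Finset α)}
    {f : Finset α → ℝ} {x d : α → ℝ} (hx : x ∈ setPolyhedron D f)
    (hd : ∀ A ∈ D, ∑ s ∈ A, x s = f A → ∑ s ∈ A, d s ≤ 0) :
    ∀ᶠ t in nhdsWithin (0 : ℝ) (Set.Ioi 0), x + t • d ∈ setPolyhedron D f := by
  have key : ∀ A : Finset α, ∀ᶠ t in nhdsWithin (0 : ℝ) (Set.Ioi 0),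
      A ∈ D → ∑ s ∈ A, (x + t • d) s ≤ f A := by
    intro A
    by_cases hA : A ∈ D
    swap
    · exact Filter.Eventually.of_forall fun t h => absurd h hA
    rcases (hx A hA).eq_or_lt with h | h
    · filter_upwards [self_mem_nhdsWithin] with t ht _
      rw [sum_add_smul_apply]
      have := mul_nonpos_of_nonneg_of_nonpos (le_of_lt (Set.mem_Ioi.1 ht)) (hd A hA h)
      linarith
    · have hc : Continuous fun t : ℝ => ∑ s ∈ A, x s + t * ∑ s ∈ A, d s := by fun_prop
      have := (hc.tendsto 0).eventually_lt_const (u := f A) (by simpa using h)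
      filter_upwards [nhdsWithin_le_nhds this] with t ht _
      rw [sum_add_smul_apply]
      exact ht.le
  filter_upwards [Filter.eventually_all.2 key] with t ht A hA using ht A hA

theorem sum_mul_nonpos_of_isMax {α : Type*} [Fintype α] {D : Set (Finset α)}
    {f : Finset α → ℝ} {x d c : α → ℝ} (hx : x ∈ setPolyhedron D f)
    (hmax : ∀ z ∈ setPolyhedron D f, ∑ s, c s * z s ≤ ∑ s, c s * x s)
    (hd : ∀ A ∈ D, ∑ s ∈ A, x s = f A → ∑ s ∈ A, d s ≤ 0) :
    ∑ s, c s * d s ≤ 0 := by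
  obtain ⟨t, ht, htpos⟩ :=
    ((eventually_add_smul_mem_setPolyhedron hx hd).and self_mem_nhdsWithin).exists
  have h := hmax _ ht
  have e : ∑ s, c s * (x + t • d) s = ∑ s, c s * x s + t * ∑ s, c s * d s := by
    rw [Finset.mul_sum, ← Finset.sum_add_distrib]
    refine Finset.sum_congr rfl fun s _ => ?_
    simp only [Pi.add_apply, Pi.smul_apply, smul_eq_mul]
    ring
  rw [e] at h
  have htpos' : 0 < t := htpos
  by_contra! hcon
  have := mul_pos htpos' hcon
  linarith

/-- At an extreme point, the tight constraints separate points. -/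
theorem eq_zero_of_mem_extremePoints {α : Type*} [Finite α] {D : Set (Finset α)}
    {f : Finset α → ℝ} {x d : α → ℝ} (hx : x ∈ Set.extremePoints ℝ (setPolyhedron D f))
    (hd : ∀ A ∈ D, ∑ s ∈ A, x s = f A → ∑ s ∈ A, d s = 0) : d = 0 := by
  have h1 := eventually_add_smul_mem_setPolyhedron hx.1 fun A hA h => (hd A hA h).le
  have h2 := eventually_add_smul_mem_setPolyhedron (d := -d) hx.1
    fun A hA h => by simp [hd A hA h]
  obtain ⟨t, ⟨ht1, ht2⟩, htpos⟩ := ((h1.and h2).and self_mem_nhdsWithin).exists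
  have hseg : x ∈ openSegment ℝ (x + t • d) (x + t • -d) := by
    refine ⟨1 / 2, 1 / 2, by norm_num, by norm_num, by norm_num, ?_⟩
    ext s
    simp only [Pi.add_apply, Pi.smul_apply, Pi.neg_apply, smul_eq_mul]
    ring
  have h := hx.2 ht1 ht2 hseg
  have h' : t • d = 0 := by simpa using h
  exact (smul_eq_zero.1 h').resolve_left (ne_of_gt htpos)

theorem initSeg_symmDiff_subset {n : ℕ} (T : Finset (Fin n)) (i : ℕ) :
    initSeg n i ∆ T ⊆ (Tᶜ.filter fun j => (j : ℕ) < i) ∪ T.filter fun j => i ≤ (j : ℕ) := by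
  intro j
  simp only [initSeg, Finset.mem_symmDiff, Finset.mem_union, Finset.mem_filter,
    Finset.mem_compl, Finset.mem_univ, true_and, not_lt]
  tauto

/-- A set far from every initial segment has many disjoint inversions. -/
theorem exists_lt_pairing {n m : ℕ} (T : Finset (Fin n))
    (hT : ∀ i ≤ n, m ≤ (initSeg n i ∆ T).card) :
    ∃ u v : Fin m → Fin n, Function.Injective u ∧ Function.Injective v ∧
      (∀ i, u i ∉ T) ∧ (∀ i, v i ∈ T) ∧ ∀ i, u i < v i := by
  have hmT : m ≤ T.card := by
    have h0 : initSeg n 0 = ∅ := by ext; simp [initSeg]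
    have h := hT 0 (Nat.zero_le n)
    rw [h0, ← Finset.bot_eq_empty, bot_symmDiff] at h
    exact h
  have hmC : m ≤ Tᶜ.card := by
    have h0 : initSeg n n = Finset.univ := by ext; simp [initSeg]
    have h := hT n le_rfl
    rw [h0, ← Finset.top_eq_univ, top_symmDiff] at h
    exact h
  let p := Tᶜ.orderEmbOfFin rfl
  let q := T.orderEmbOfFin rfl
  let a : Fin m → Fin Tᶜ.card := Fin.castLE hmC
  let b : Fin m → Fin T.card := fun i => ⟨T.card - m + i, by omega⟩
  have hp : ∀ i, p i ∉ T := fun i => Finset.mem_compl.1 (Finset.orderEmbOfFin_mem _ _ _)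
  have hq : ∀ i, q i ∈ T := fun i => Finset.orderEmbOfFin_mem _ _ _
  refine ⟨fun i => p (a i), fun i => q (b i), ?_, ?_, fun i => hp _, fun i => hq _, ?_⟩
  · exact p.injective.comp (Fin.castLE_injective hmC)
  · refine q.injective.comp fun i j hij => ?_
    simp only [b, Fin.mk.injEq] at hij
    omega
  intro i
  by_contra! hle
  have hlt : q (b i) < p (a i) :=
    lt_of_le_of_ne hle fun h => hp (a i) (h ▸ hq (b i))
  have hP : (Tᶜ.filter fun j : Fin n => (j : ℕ) < (p (a i) : ℕ)) ⊆
      (Finset.Iio (a i)).map p.toEmbedding := by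
    intro j hj
    obtain ⟨hjT, hji⟩ := Finset.mem_filter.1 hj
    have : j ∈ Set.range p := by
      rw [Finset.range_orderEmbOfFin]; exact hjT
    obtain ⟨l, rfl⟩ := this
    exact Finset.mem_map_of_mem _ (Finset.mem_Iio.2 (p.lt_iff_lt.1 hji))
  have hQ : (T.filter fun j : Fin n => (p (a i) : ℕ) ≤ (j : ℕ)) ⊆
      (Finset.Ioi (b i)).map q.toEmbedding := by
    intro j hj
    obtain ⟨hjT, hji⟩ := Finset.mem_filter.1 hj
    have : j ∈ Set.range q := by
      rw [Finset.range_orderEmbOfFin]; exact hjT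
    obtain ⟨l, rfl⟩ := this
    exact Finset.mem_map_of_mem _ (Finset.mem_Ioi.2 (q.lt_iff_lt.1 (lt_of_lt_of_le hlt hji)))
  have h1 := Finset.card_le_card hP
  have h2 := Finset.card_le_card hQ
  have h3 := Finset.card_le_card (initSeg_symmDiff_subset T (p (a i)))
  have h4 := hT (p (a i)) (p (a i)).isLt.le
  have h5 := Finset.card_union_le (Tᶜ.filter fun j : Fin n => (j : ℕ) < (p (a i) : ℕ))
    (T.filter fun j : Fin n => (p (a i) : ℕ) ≤ (j : ℕ))
  rw [Finset.card_map, Fin.card_Iio] at h1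
  rw [Finset.card_map, Fin.card_Ioi] at h2
  have ha : (a i : ℕ) = i := rfl
  have hb : (b i : ℕ) = T.card - m + i := rfl
  have := i.isLt
  omega

/-- For a set `T` far from every initial segment, some direction improves every strictly decreasing
objective without increasing on sets that are comparable with, or close to, `T`. -/
theorem exists_improving_direction {n m : ℕ} (hm : 0 < m) (T : Finset (Fin n))
    (hT : ∀ i ≤ n, m ≤ (initSeg n i ∆ T).card) (c : Fin n → ℝ)
    (hc : ∀ i j : Fin n, i < j → c j < c i) :
    ∃ y : Fin n → ℝ, 0 < ∑ s, c s * y s ∧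
      ∀ B : Finset (Fin n), B ⊆ T ∨ T ⊆ B ∨ (B ∆ T).card ≤ m → ∑ s ∈ B, y s ≤ 0 := by
  obtain ⟨u, v, hu, hv, huT, hvT, huv⟩ := exists_lt_pairing T hT
  let y : Fin n → ℝ := fun s =>
    ∑ i, ((if u i = s then 1 else 0) - (if v i = s then 1 else 0))
  have hyB : ∀ B : Finset (Fin n), ∑ s ∈ B, y s =
      ∑ i, (((if u i ∈ B then 1 else 0) - (if v i ∈ B then 1 else 0) : ℝ)) := by
    intro B
    simp only [y]
    rw [Finset.sum_comm]
    simp [Finset.sum_sub_distrib]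
  refine ⟨y, ?_, ?_⟩
  · have : ∑ s, c s * y s = ∑ i, (c (u i) - c (v i)) := by
      simp only [y, Finset.mul_sum]
      rw [Finset.sum_comm]
      simp [mul_sub, Finset.sum_sub_distrib]
    rw [this]
    exact Finset.sum_pos (fun i _ => sub_pos.2 (hc _ _ (huv i))) ⟨⟨0, hm⟩, Finset.mem_univ _⟩
  · intro B hB
    rw [hyB]
    rcases hB with hB | hB | hB
    · refine Finset.sum_nonpos fun i _ => ?_
      rw [if_neg fun h => huT i (hB h)]
      split_ifs <;> norm_num
    · refine Finset.sum_nonpos fun i _ => ?_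
      rw [if_pos (hB (hvT i))]
      split_ifs <;> norm_num
    · have h1 : (Finset.univ.filter fun i => u i ∈ B).card ≤ (B \ T).card :=
        Finset.card_le_card_of_injOn u
          (fun i hi => by
            simp only [Finset.coe_filter, Finset.mem_univ, true_and, Set.mem_ofPred_eq] at hi
            simpa using ⟨hi, huT i⟩) hu.injOn
      have h2 : (Finset.univ.filter fun i => v i ∉ B).card ≤ (T \ B).card :=
        Finset.card_le_card_of_injOn v
          (fun i hi => by
            simp only [Finset.coe_filter, Finset.mem_univ, true_and, Set.mem_ofPred_eq] at hi
            simpa using ⟨hvT i, hi⟩) hv.injOn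
      have h3 : (B ∆ T).card = (B \ T).card + (T \ B).card :=
        Finset.card_union_of_disjoint disjoint_sdiff_sdiff
      have h4 := Finset.card_filter_add_card_filter_not
        (s := (Finset.univ : Finset (Fin m))) (fun i => v i ∈ B)
      rw [Finset.card_univ, Fintype.card_fin] at h4
      rw [Finset.sum_sub_distrib, Finset.sum_boole, Finset.sum_boole, sub_nonpos]
      exact_mod_cast (by omega :
        (Finset.univ.filter fun i => u i ∈ B).card ≤ (Finset.univ.filter fun i => v i ∈ B).card)

/-- If the submodular inequality is strict on distant incomparable pairs, a maximizer of a strictly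
decreasing objective is tight only on sets near initial segments. -/
theorem mem_nearInitSeg_of_tight {n k : ℕ} (hk : 2 ≤ k) {h : Finset (Fin n) → ℝ}
    (hh : ∀ X Y : Finset (Fin n), k ≤ (X ∆ Y).card → ¬ X ⊆ Y → ¬ Y ⊆ X →
      h (X ∪ Y) + h (X ∩ Y) < h X + h Y)
    {c x : Fin n → ℝ} (hc : ∀ i j : Fin n, i < j → c j < c i)
    (hx : x ∈ setPolyhedron Set.univ h)
    (hmax : ∀ z ∈ setPolyhedron Set.univ h, ∑ s, c s * z s ≤ ∑ s, c s * x s)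
    {T : Finset (Fin n)} (hT : ∑ s ∈ T, x s = h T) : T ∈ nearInitSeg n (k - 2) := by
  by_contra hTC
  have hfar : ∀ i ≤ n, k - 1 ≤ (initSeg n i ∆ T).card := by
    intro i hi
    by_contra! hlt
    exact hTC ⟨i, hi, initSeg n i ∆ T, by omega, by simp⟩
  obtain ⟨y, hy, hyB⟩ := exists_improving_direction (by omega) T hfar c hc
  refine absurd (sum_mul_nonpos_of_isMax hx hmax fun B _ hB => hyB B ?_) (not_le.2 hy)
  by_contra! hcon
  have hlt := hh B T (by omega) hcon.1 hcon.2.1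
  have h1 := hx (B ∪ T) trivial
  have h2 := hx (B ∩ T) trivial
  have h3 := Finset.sum_union_inter (s₁ := B) (s₂ := T) (f := x)
  linarith

theorem exists_isMax_setPolyhedron {n : ℕ} {h : Finset (Fin n) → ℝ} (h0 : 0 ≤ h ∅)
    {c : Fin n → ℝ} (hc : ∀ s, 0 < c s) :
    ∃ x ∈ setPolyhedron Set.univ h,
      ∀ z ∈ setPolyhedron Set.univ h, ∑ s, c s * z s ≤ ∑ s, c s * x s := by
  let M : ℝ := ∑ A, |h A|
  have hM : ∀ A, |h A| ≤ M := fun A =>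
    Finset.single_le_sum (f := fun A => |h A|) (fun _ _ => abs_nonneg _) (Finset.mem_univ A)
  have hM0 : 0 ≤ M := (abs_nonneg _).trans (hM ∅)
  let p : Fin n → ℝ := fun _ => -M
  have hp : p ∈ setPolyhedron Set.univ h := by
    intro A _
    rcases A.eq_empty_or_nonempty with rfl | hA
    · simpa using h0
    · have h1 : (1 : ℝ) ≤ A.card := by exact_mod_cast hA.card_pos
      have h2 := neg_le_of_abs_le (hM A)
      simp only [p, Finset.sum_const, nsmul_eq_mul]
      nlinarith
  let K : Set (Fin n → ℝ) :=
    setPolyhedron Set.univ h ∩ {x | ∑ s, c s * p s ≤ ∑ s, c s * x s}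
  have hclosed : IsClosed K := by
    have : K = (⋂ A : Finset (Fin n), {x | ∑ s ∈ A, x s ≤ h A}) ∩
        {x | ∑ s, c s * p s ≤ ∑ s, c s * x s} := by
      ext x; simp [K, setPolyhedron]
    rw [this]
    refine (isClosed_iInter fun A => isClosed_le (by fun_prop) (by fun_prop)).inter
      (isClosed_le (by fun_prop) (by fun_prop))
  have hsub : K ⊆ Set.Icc
      (fun s => (∑ s, c s * p s - ∑ j ∈ Finset.univ.erase s, c j * M) / c s) fun _ => M := by
    intro x hx
    have hupper : ∀ s, x s ≤ M := fun s =>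
      (by simpa using hx.1 {s} trivial : x s ≤ h {s}).trans ((le_abs_self _).trans (hM _))
    refine ⟨fun s => ?_, hupper⟩
    rw [div_le_iff₀ (hc s), sub_le_iff_le_add]
    have h1 : ∑ s, c s * p s ≤ ∑ s, c s * x s := hx.2
    rw [← Finset.add_sum_erase _ (fun j => c j * x j) (Finset.mem_univ s)] at h1
    have h2 : ∑ j ∈ Finset.univ.erase s, c j * x j ≤ ∑ j ∈ Finset.univ.erase s, c j * M :=
      Finset.sum_le_sum fun j _ => mul_le_mul_of_nonneg_left (hupper j) (hc j).le
    linarith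
  have hK : IsCompact K := isCompact_Icc.of_isClosed_subset hclosed hsub
  obtain ⟨x, hx, hmax⟩ := hK.exists_isMaxOn (f := fun x => ∑ s, c s * x s)
    ⟨p, hp, le_refl (∑ s, c s * p s)⟩ (by fun_prop)
  refine ⟨x, hx.1, fun z hz => ?_⟩
  by_cases hzp : ∑ s, c s * p s ≤ ∑ s, c s * z s
  · exact hmax ⟨hz, hzp⟩
  · exact (not_le.1 hzp).le.trans hx.2

/-- Subtracting a positive multiple of the squared cardinality makes submodular inequalities between
incomparable sets strict. -/
theorem DistantSubmodular.sub_sq_card_lt {α : Type*} [DecidableEq α] {k : ℕ}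
    {f : Finset α → ℝ} (hf : DistantSubmodular k f) {δ : ℝ} (hδ : 0 < δ) {X Y : Finset α}
    (hk : k ≤ (X ∆ Y).card) (hXY : ¬ X ⊆ Y) (hYX : ¬ Y ⊆ X) :
    (f (X ∪ Y) - δ * ((X ∪ Y).card : ℝ) ^ 2) + (f (X ∩ Y) - δ * ((X ∩ Y).card : ℝ) ^ 2) <
      (f X - δ * (X.card : ℝ) ^ 2) + (f Y - δ * (Y.card : ℝ) ^ 2) := by
  have h1 := hf X Y hk
  have hX : (0 : ℝ) < (X \ Y).card := by
    exact_mod_cast Finset.card_pos.2 (Finset.sdiff_nonempty.2 hXY)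
  have hY : (0 : ℝ) < (Y \ X).card := by
    exact_mod_cast Finset.card_pos.2 (Finset.sdiff_nonempty.2 hYX)
  have e1 : (X.card : ℝ) = (X \ Y).card + (X ∩ Y).card := by
    exact_mod_cast (Finset.card_sdiff_add_card_inter X Y).symm
  have e2 : (Y.card : ℝ) = (Y \ X).card + (X ∩ Y).card := by
    rw [Finset.inter_comm]
    exact_mod_cast (Finset.card_sdiff_add_card_inter Y X).symm
  have e3 : ((X ∪ Y).card : ℝ) = X.card + Y.card - (X ∩ Y).card := by
    have := Finset.card_union_add_card_inter X Y
    rw [eq_sub_iff_add_eq]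
    exact_mod_cast this
  rw [e3, e1, e2]
  nlinarith [mul_pos hδ (mul_pos hX hY)]

/-- There are points of the full polyhedron of `f` that are nearly optimal for the polyhedron
restricted to the sets near initial segments. -/
theorem exists_nearly_optimal {n k : ℕ} (hk : 2 ≤ k) {f : Finset (Fin n) → ℝ}
    (hf : DistantSubmodular k f) (hf0 : f ∅ = 0) {c x : Fin n → ℝ} (hcpos : ∀ s, 0 < c s)
    (hc : ∀ i j : Fin n, i < j → c j < c i)
    (hx : x ∈ setPolyhedron (nearInitSeg n (k - 2)) f) {δ : ℝ} (hδ : 0 < δ) :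
    ∃ z ∈ setPolyhedron Set.univ f,
      ∑ s, c s * x s - δ * (n * ∑ s, c s) ≤ ∑ s, c s * z s := by
  let h : Finset (Fin n) → ℝ := fun A => f A - δ * (A.card : ℝ) ^ 2
  have hh : ∀ X Y : Finset (Fin n), k ≤ (X ∆ Y).card → ¬ X ⊆ Y → ¬ Y ⊆ X →
      h (X ∪ Y) + h (X ∩ Y) < h X + h Y := fun X Y h1 h2 h3 => hf.sub_sq_card_lt hδ h1 h2 h3
  obtain ⟨z, hz, hmax⟩ := exists_isMax_setPolyhedron (h := h) (by simp [h, hf0]) hcpos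
  refine ⟨z, fun A hA => (hz A hA).trans ?_, ?_⟩
  · have : 0 ≤ δ * (A.card : ℝ) ^ 2 := by positivity
    simp only [h]
    linarith
  · let q : Fin n → ℝ := fun s => x s - δ * n
    have hq : q ∈ setPolyhedron (nearInitSeg n (k - 2)) h := by
      intro A hA
      have h1 := hx A hA
      have h2 : (A.card : ℝ) ≤ n := by
        exact_mod_cast (Finset.card_le_univ A).trans (Fintype.card_fin n).le
      have h3 : (A.card : ℝ) * A.card ≤ A.card * n :=
        mul_le_mul_of_nonneg_left h2 (Nat.cast_nonneg _)
      simp only [q, h, Finset.sum_sub_distrib, Finset.sum_const, nsmul_eq_mul]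
      nlinarith
    have hdir := sum_mul_nonpos_of_isMax (d := q - z) hz hmax fun A _ hA => by
      have := hq A (mem_nearInitSeg_of_tight hk hh hc hz hmax hA)
      simp only [Pi.sub_apply, Finset.sum_sub_distrib]
      linarith
    have e : ∑ s, c s * (q - z) s =
        ∑ s, c s * x s - δ * (n * ∑ s, c s) - ∑ s, c s * z s := by
      simp only [Finset.mul_sum, ← Finset.sum_sub_distrib]
      refine Finset.sum_congr rfl fun s _ => ?_
      simp only [q, Pi.sub_apply]
      ring
    linarith

theorem exists_pos_add_mul_strictAnti {n : ℕ} {w : Fin n → ℝ}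
    (hw : ∀ i j : Fin n, i < j → w j < w i) (a : Fin n → ℝ) :
    ∃ η > 0, ∀ i j : Fin n, i < j → w j + η * a j < w i + η * a i := by
  have key : ∀ i j : Fin n, ∀ᶠ η in nhdsWithin (0 : ℝ) (Set.Ioi 0),
      i < j → w j + η * a j < w i + η * a i := by
    intro i j
    by_cases hij : i < j
    · have h1 : Continuous fun η : ℝ => w j + η * a j := by fun_prop
      have h2 : Continuous fun η : ℝ => w i + η * a i := by fun_prop
      have := (h1.tendsto 0).eventually_lt (h2.tendsto 0) (by simpa using hw i j hij)
      filter_upwards [nhdsWithin_le_nhds this] with η hη _ using hη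
    · exact Filter.Eventually.of_forall fun _ h => absurd h hij
  obtain ⟨η, h, hη⟩ := ((Filter.eventually_all.2 fun i => Filter.eventually_all.2 (key i)).and
    self_mem_nhdsWithin).exists
  exact ⟨η, hη, h⟩

/-- If linear constraints separating points are all small at `d`, so is every subset sum of `d`. -/
theorem exists_abs_sum_le_of_separating {α : Type*} [Fintype α] (t : Finset (Finset α))
    (ht : ∀ d : α → ℝ, (∀ A ∈ t, ∑ s ∈ A, d s = 0) → d = 0) (T : Finset α) :
    ∃ M : ℝ, ∀ (d : α → ℝ) (r : ℝ), (∀ A ∈ t, |∑ s ∈ A, d s| ≤ r) → |∑ s ∈ T, d s| ≤ M * r := by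
  let L : Finset α → (α → ℝ) →ₗ[ℝ] ℝ := fun A => ∑ s ∈ A, LinearMap.proj s
  have hL : ∀ A d, L A d = ∑ s ∈ A, d s := fun A d => by simp [L]
  have hmem : L T ∈ Submodule.span ℝ (Set.range fun A : t => L A) := by
    refine mem_span_of_iInf_ker_le_ker fun d hd => ?_
    have : d = 0 := ht d fun A hA => by
      have := (Submodule.mem_iInf _).1 hd ⟨A, hA⟩
      rw [← hL]
      exact this
    simp [this]
  obtain ⟨a, ha⟩ := (Submodule.mem_span_range_iff_exists_fun ℝ).1 hmem
  refine ⟨∑ A, |a A|, fun d r hd => ?_⟩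
  have e : ∑ s ∈ T, d s = ∑ A : t, a A * ∑ s ∈ A.1, d s := by
    rw [← hL, ← ha]
    simp [hL]
  rw [e, Finset.sum_mul]
  refine (Finset.abs_sum_le_sum_abs _ _).trans (Finset.sum_le_sum fun A _ => ?_)
  rw [abs_mul]
  exact mul_le_mul_of_nonneg_left (hd A A.2) (abs_nonneg _)

theorem stmt_4 (n k : ℕ) (hk2 : 2 ≤ k) (hkn : k ≤ n)
    (f : Finset (Fin n) → ℝ) (hf : DistantSubmodular k f) (hf0 : f ∅ = 0)
    (w : Fin n → ℝ) (hw_nonneg : ∀ s : Fin n, 0 ≤ w s)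
    (hw_strict : ∀ i j : Fin n, i < j → w j < w i)
    (C : Set (Finset (Fin n)))
    (hC : C = {U | ∃ i ≤ n, ∃ T : Finset (Fin n), T.card ≤ k - 2 ∧ U = initSeg n i ∆ T})
    (PC : Set (Fin n → ℝ))
    (hPC : PC = {x | ∀ T ∈ C, ∑ s ∈ T, x s ≤ f T})
    (xstar : Fin n → ℝ) (hxstar : xstar ∈ Set.extremePoints ℝ PC)
    (hopt : ∀ x ∈ PC, ∑ s : Fin n, w s * x s ≤ ∑ s : Fin n, w s * xstar s) :
    ∀ T : Finset (Fin n), ∑ s ∈ T, xstar s ≤ f T := by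
  classical
  replace hC : C = nearInitSeg n (k - 2) := hC
  replace hPC : PC = setPolyhedron C f := hPC
  subst hPC hC
  intro T
  let t : Finset (Finset (Fin n)) :=
    Finset.univ.filter fun A => A ∈ nearInitSeg n (k - 2) ∧ ∑ s ∈ A, xstar s = f A
  have ht : ∀ d : Fin n → ℝ, (∀ A ∈ t, ∑ s ∈ A, d s = 0) → d = 0 := fun d hd =>
    eq_zero_of_mem_extremePoints hxstar fun A hA h => hd A (by simp [t, hA, h])
  let a : Fin n → ℝ := fun s => ∑ A ∈ t, if s ∈ A then 1 else 0
  have hasum : ∀ d : Fin n → ℝ, ∑ s, a s * d s = ∑ A ∈ t, ∑ s ∈ A, d s := by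
    intro d
    simp only [a, Finset.sum_mul]
    rw [Finset.sum_comm]
    simp
  have hapos : ∀ s, 0 < a s := by
    intro s
    have hs : ∃ A ∈ t, s ∈ A := by
      by_contra! hcon
      have h := congrFun (ht (Pi.single s 1) fun A hA => by
        refine Finset.sum_eq_zero fun j hj => Pi.single_eq_of_ne ?_ _
        rintro rfl
        exact hcon A hA hj) s
      simp at h
    obtain ⟨A, hA, hsA⟩ := hs
    exact Finset.sum_pos' (fun A _ => by split_ifs <;> norm_num) ⟨A, hA, by simp [hsA]⟩
  obtain ⟨η, hη, hanti⟩ := exists_pos_add_mul_strictAnti hw_strict a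
  let c : Fin n → ℝ := fun s => w s + η * a s
  have hcpos : ∀ s, 0 < c s := fun s =>
    add_pos_of_nonneg_of_pos (hw_nonneg s) (mul_pos hη (hapos s))
  obtain ⟨M, hM⟩ := exists_abs_sum_le_of_separating t ht T
  have hbound : ∀ δ > 0, ∑ s ∈ T, xstar s ≤ f T + M * (δ * (n * ∑ s, c s) / η) := by
    intro δ hδ
    obtain ⟨z, hz, hzc⟩ := exists_nearly_optimal hk2 hf hf0 hcpos hanti hxstar.1 hδ
    have hzw := hopt z fun A _ => hz A trivial
    have hneg : ∀ A ∈ t, ∑ s ∈ A, (z - xstar) s ≤ 0 := by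
      intro A hA
      have h1 := hz A trivial
      have h2 := (Finset.mem_filter.1 hA).2.2
      simp only [Pi.sub_apply, Finset.sum_sub_distrib]
      linarith
    have hsum : -(δ * (n * ∑ s, c s)) ≤ η * ∑ A ∈ t, ∑ s ∈ A, (z - xstar) s := by
      rw [← hasum]
      have e : η * ∑ s, a s * (z - xstar) s = (∑ s, c s * z s - ∑ s, c s * xstar s) -
          (∑ s, w s * z s - ∑ s, w s * xstar s) := by
        simp only [Finset.mul_sum, ← Finset.sum_sub_distrib]
        refine Finset.sum_congr rfl fun s _ => ?_
        simp only [c, Pi.sub_apply]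
        ring
      rw [e]
      linarith
    have h := hM (z - xstar) (δ * (n * ∑ s, c s) / η) fun A hA => by
      rw [abs_of_nonpos (hneg A hA), le_div_iff₀ hη]
      have h1 : ∑ B ∈ t, ∑ s ∈ B, (z - xstar) s ≤ ∑ s ∈ A, (z - xstar) s := by
        rw [← Finset.add_sum_erase _ _ hA]
        have := Finset.sum_nonpos fun B (hB : B ∈ t.erase A) => hneg B (Finset.mem_of_mem_erase hB)
        linarith
      have h2 := mul_le_mul_of_nonneg_left h1 hη.le
      linarith
    have h1 := neg_le_of_abs_le h
    have h2 := hz T trivial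
    simp only [Pi.sub_apply, Finset.sum_sub_distrib] at h1
    linarith
  have hcont : Continuous fun δ : ℝ => f T + M * (δ * (n * ∑ s, c s) / η) := by fun_prop
  have hlim := (hcont.tendsto 0).mono_left (nhdsWithin_le_nhds (s := Set.Ioi 0))
  have hle := ge_of_tendsto hlim
    (Filter.eventually_of_mem self_mem_nhdsWithin fun δ hδ => hbound δ hδ)
  simpa using hle
end

section
/- Let M_1 = (S, I_1) and M_2 = (S, I_2) be matroids on the same finite ground set S with rank functions r_1 and r_2, and suppose r_1(S) = r_2(S) = r. Let k be a positive integer with k ≤ r, and suppose that for every X ⊆ S and i = 1, 2: r_i(X) = |X| whenever |X| ≤ r − k, and r_i(X) = r whenever |X| ≥ r + k. Then the minimum rank function r_min : 2^S → ℤ, defined by r_min(X) = min{r_1(X), r_2(X)}, is 4k-distant submodular. -/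
open scoped symmDiff Classical

/-- An integer-valued set function `f` is `k`-distant submodular if the submodular
inequality holds for every pair whose symmetric difference has size at least `k`. -/
def DistantSubmodularInt {α : Type*} [DecidableEq α] (k : ℕ) (f : Finset α → ℤ) : Prop :=
  ∀ X Y : Finset α, k ≤ (X ∆ Y).card → f (X ∪ Y) + f (X ∩ Y) ≤ f X + f Y

/-- `Indep` is the independent-set family of a matroid: it contains the empty set,
is closed under taking subsets, and satisfies the exchange axiom. -/
def IsMatroidIndep {α : Type*} [DecidableEq α] (Indep : Finset α → Prop) : Prop :=
  Indep ∅ ∧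
  (∀ X Y : Finset α, X ⊆ Y → Indep Y → Indep X) ∧
  (∀ X Y : Finset α, Indep X → Indep Y → X.card < Y.card →
    ∃ e ∈ Y \ X, Indep (insert e X))

/-- The rank function of the matroid with independent-set family `Indep`:
the maximum cardinality of an independent subset. -/
noncomputable def rankOf {α : Type*} [DecidableEq α] (Indep : Finset α → Prop)
    (X : Finset α) : ℤ :=
  (((X.powerset.filter Indep).sup Finset.card : ℕ) : ℤ)

section Rank

variable {α : Type*} [DecidableEq α] {Indep : Finset α → Prop}

lemma IsMatroidIndep.card_le_rankOf {I X : Finset α} (hI : Indep I) (hIX : I ⊆ X) :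
    (I.card : ℤ) ≤ rankOf Indep X := by
  unfold rankOf
  exact_mod_cast Finset.le_sup (f := Finset.card)
    (Finset.mem_filter.2 ⟨Finset.mem_powerset.2 hIX, hI⟩)

lemma IsMatroidIndep.exists_card_eq_rankOf (h : IsMatroidIndep Indep) (X : Finset α) :
    ∃ I ⊆ X, Indep I ∧ (I.card : ℤ) = rankOf Indep X := by
  have hne : (X.powerset.filter Indep).Nonempty :=
    ⟨∅, Finset.mem_filter.2 ⟨Finset.empty_mem_powerset X, h.1⟩⟩
  obtain ⟨I, hI, hcard⟩ := Finset.exists_mem_eq_sup _ hne Finset.card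
  obtain ⟨hIX, hind⟩ := Finset.mem_filter.1 hI
  refine ⟨I, Finset.mem_powerset.1 hIX, hind, ?_⟩
  unfold rankOf
  exact_mod_cast hcard.symm

lemma IsMatroidIndep.exists_superset_card_eq_rankOf (h : IsMatroidIndep Indep)
    {I X : Finset α} (hI : Indep I) (hIX : I ⊆ X) :
    ∃ J, I ⊆ J ∧ J ⊆ X ∧ Indep J ∧ (J.card : ℤ) = rankOf Indep X := by
  obtain ⟨B, hBX, hB, hBcard⟩ := h.exists_card_eq_rankOf X
  have hne : (X.powerset.filter fun J => I ⊆ J ∧ Indep J).Nonempty :=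
    ⟨I, Finset.mem_filter.2 ⟨Finset.mem_powerset.2 hIX, subset_rfl, hI⟩⟩
  obtain ⟨J, hJ, hmax⟩ := Finset.exists_max_image _ Finset.card hne
  obtain ⟨hJX, hIJ, hJind⟩ := Finset.mem_filter.1 hJ
  rw [Finset.mem_powerset] at hJX
  refine ⟨J, hIJ, hJX, hJind, le_antisymm (card_le_rankOf hJind hJX) ?_⟩
  rw [← hBcard]
  by_contra! hlt
  obtain ⟨e, he, heJ⟩ := h.2.2 J B hJind hB (by exact_mod_cast hlt)
  obtain ⟨heB, heJ'⟩ := Finset.mem_sdiff.1 he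
  have := hmax (insert e J) (Finset.mem_filter.2
    ⟨Finset.mem_powerset.2 (Finset.insert_subset (hBX heB) hJX),
      hIJ.trans (Finset.subset_insert e J), heJ⟩)
  rw [Finset.card_insert_of_notMem heJ'] at this
  omega

lemma IsMatroidIndep.rankOf_mono (h : IsMatroidIndep Indep) {X Y : Finset α} (hXY : X ⊆ Y) :
    rankOf Indep X ≤ rankOf Indep Y := by
  obtain ⟨I, hIX, hI, hcard⟩ := h.exists_card_eq_rankOf X
  exact hcard ▸ card_le_rankOf hI (hIX.trans hXY)

lemma IsMatroidIndep.rankOf_le_card (h : IsMatroidIndep Indep) (X : Finset α) :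
    rankOf Indep X ≤ X.card := by
  obtain ⟨I, hIX, -, hcard⟩ := h.exists_card_eq_rankOf X
  exact hcard ▸ (by exact_mod_cast Finset.card_le_card hIX)

lemma IsMatroidIndep.rankOf_union_add_rankOf_inter_le (h : IsMatroidIndep Indep)
    (X Y : Finset α) :
    rankOf Indep (X ∪ Y) + rankOf Indep (X ∩ Y) ≤ rankOf Indep X + rankOf Indep Y := by
  obtain ⟨I, hI, hIind, hIcard⟩ := h.exists_card_eq_rankOf (X ∩ Y)
  obtain ⟨J, hIJ, hJ, hJind, hJcard⟩ := h.exists_superset_card_eq_rankOf hIind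
    (hI.trans (Finset.inter_subset_left.trans Finset.subset_union_left : X ∩ Y ⊆ X ∪ Y))
  have hX := card_le_rankOf (h.2.1 _ _ Finset.inter_subset_left hJind)
    (Finset.inter_subset_right : J ∩ X ⊆ X)
  have hY := card_le_rankOf (h.2.1 _ _ Finset.inter_subset_left hJind)
    (Finset.inter_subset_right : J ∩ Y ⊆ Y)
  have hcard := Finset.card_union_add_card_inter (J ∩ X) (J ∩ Y)
  have hunion : J ∩ X ∪ J ∩ Y = J := by
    rw [← Finset.inter_union_distrib_left, Finset.inter_eq_left.2 hJ]
  have hinter : I.card ≤ (J ∩ X ∩ (J ∩ Y)).card :=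
    Finset.card_le_card (by grind)
  rw [hunion] at hcard
  omega

lemma IsMatroidIndep.rankOf_le_rankOf_add_card_sdiff (h : IsMatroidIndep Indep)
    (X T : Finset α) : rankOf Indep T ≤ rankOf Indep X + (T \ X).card := by
  have h1 := h.rankOf_union_add_rankOf_inter_le X (T \ X)
  have h2 := h.rankOf_mono (by simp : T ⊆ X ∪ T \ X)
  have h3 := h.rankOf_le_card (T \ X)
  have h4 : 0 ≤ rankOf Indep (X ∩ (T \ X)) := Int.natCast_nonneg _
  omega

lemma IsMatroidIndep.sub_le_rankOf (h : IsMatroidIndep Indep) {r : ℤ} {k : ℕ}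
    (hkr : (k : ℤ) ≤ r) (hlow : ∀ X : Finset α, (X.card : ℤ) ≤ r - k → rankOf Indep X = X.card)
    {X : Finset α} (hX : r - k ≤ X.card) : r - k ≤ rankOf Indep X := by
  obtain ⟨Z, hZX, hZ⟩ := Finset.exists_subset_card_eq (n := (r - k).toNat) (s := X) (by omega)
  have h1 := hlow Z (by omega)
  have h2 := h.rankOf_mono hZX
  omega

lemma IsMatroidIndep.card_sub_le_rankOf (h : IsMatroidIndep Indep) {r : ℤ} {k : ℕ}
    (hhigh : ∀ X : Finset α, r + k ≤ (X.card : ℤ) → rankOf Indep X = r)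
    {X U : Finset α} (hXU : X ⊆ U) (hX : X.card ≤ r + k) (hU : r + k ≤ U.card) :
    (X.card : ℤ) - k ≤ rankOf Indep X := by
  obtain ⟨T, hXT, -, hT⟩ := Finset.exists_subsuperset_card_eq (n := (r + k).toNat) hXU
    (by omega) (by omega)
  have h1 := hhigh T (by omega)
  have h2 := h.rankOf_le_rankOf_add_card_sdiff X T
  have h3 := Finset.card_sdiff_add_card_eq_card hXT
  omega

end Rank

theorem stmt_7 {α : Type*} [Fintype α] [DecidableEq α]
    (I₁ I₂ : Finset α → Prop) (hI₁ : IsMatroidIndep I₁) (hI₂ : IsMatroidIndep I₂)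
    (r : ℤ) (hr₁ : rankOf I₁ Finset.univ = r) (hr₂ : rankOf I₂ Finset.univ = r)
    (k : ℕ) (hk : 1 ≤ k) (hkr : (k : ℤ) ≤ r)
    (hlow₁ : ∀ X : Finset α, (X.card : ℤ) ≤ r - k → rankOf I₁ X = X.card)
    (hlow₂ : ∀ X : Finset α, (X.card : ℤ) ≤ r - k → rankOf I₂ X = X.card)
    (hhigh₁ : ∀ X : Finset α, r + k ≤ (X.card : ℤ) → rankOf I₁ X = r)
    (hhigh₂ : ∀ X : Finset α, r + k ≤ (X.card : ℤ) → rankOf I₂ X = r) :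
    DistantSubmodularInt (4 * k) (fun X => min (rankOf I₁ X) (rankOf I₂ X)) := by
  intro X Y hXY
  have hsub₁ := hI₁.rankOf_union_add_rankOf_inter_le X Y
  have hsub₂ := hI₂.rankOf_union_add_rankOf_inter_le X Y
  have hcard := Finset.card_union_add_card_inter X Y
  have hsymm : (X ∆ Y).card + (X ∩ Y).card = (X ∪ Y).card := by
    have hdisj : Disjoint (X ∆ Y) (X ∩ Y) := disjoint_symmDiff_inf X Y
    have hunion : X ∆ Y ∪ X ∩ Y = X ∪ Y := symmDiff_sup_inf X Y
    rw [← Finset.card_union_of_disjoint hdisj, hunion]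
  have hU := hI₁.rankOf_mono (Finset.subset_univ (X ∪ Y))
  have hN := hI₁.rankOf_le_card (X ∩ Y)
  have hrank (Z : Finset α) (hZ : Z.card ≤ r - k ∨ r + k ≤ Z.card) :
      rankOf I₁ Z = rankOf I₂ Z := by
    rcases hZ with hZ | hZ
    · rw [hlow₁ Z hZ, hlow₂ Z hZ]
    · rw [hhigh₁ Z hZ, hhigh₂ Z hZ]
  dsimp only
  by_cases hX : (X.card : ℤ) ≤ r - k ∨ r + k ≤ X.card
  · have := hrank X hX
    omega
  by_cases hY : (Y.card : ℤ) ≤ r - k ∨ r + k ≤ Y.card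
  · have := hrank Y hY
    omega
  have hUcard : r + k ≤ (X ∪ Y).card := by omega
  have hX₁ := hI₁.sub_le_rankOf hkr hlow₁ (X := X) (by omega)
  have hX₂ := hI₂.sub_le_rankOf hkr hlow₂ (X := X) (by omega)
  have hY₁ := hI₁.sub_le_rankOf hkr hlow₁ (X := Y) (by omega)
  have hY₂ := hI₂.sub_le_rankOf hkr hlow₂ (X := Y) (by omega)
  have hX₁' := hI₁.card_sub_le_rankOf hhigh₁ (Finset.subset_union_left : X ⊆ X ∪ Y)
    (by omega) hUcard
  have hX₂' := hI₂.card_sub_le_rankOf hhigh₂ (Finset.subset_union_left : X ⊆ X ∪ Y)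
    (by omega) hUcard
  have hY₁' := hI₁.card_sub_le_rankOf hhigh₁ (Finset.subset_union_right : Y ⊆ X ∪ Y)
    (by omega) hUcard
  have hY₂' := hI₂.card_sub_le_rankOf hhigh₂ (Finset.subset_union_right : Y ⊆ X ∪ Y)
    (by omega) hUcard
  have hbound : r + (X ∩ Y).card ≤
      min (rankOf I₁ X) (rankOf I₂ X) + min (rankOf I₁ Y) (rankOf I₂ Y) := by
    have hXmin := le_min hX₁ hX₂
    have hYmin := le_min hY₁ hY₂
    have hXmin' := le_min hX₁' hX₂'
    have hYmin' := le_min hY₁' hY₂'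
    linarith
  calc _ ≤ rankOf I₁ (X ∪ Y) + rankOf I₁ (X ∩ Y) := add_le_add (min_le_left _ _) (min_le_left _ _)
    _ ≤ r + (X ∩ Y).card := by linarith
    _ ≤ _ := hbound
end
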